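/- (A posteriori stability of BQNL.) Let η : ℤ → [0,1] be N-periodic with β_ξ := η_ξ, let y ∈ 𝒴 with min_ξ y'_ξ ≥ r*/2 > 0, and set C̄_i := C_i(2 min_ξ y'_ξ). Then c(y) ≥ c_η(y) − 2εC̄₃ max_ξ |Δβ_ξ · y''_ξ| − 2ε² ( C̄₃ max_ξ |(1−β_{ξ−1}) y'''_ξ| + C̄₄ max_ξ |(1−β_ξ)(y''_ξ)²| ). -/

import Mathlib

open scoped BigOperators ENNReal
open Finset

noncomputable section

/-- The lattice spacing `ε = 1/N`. -/
def eps (N : ℕ) : ℝ := (N : ℝ)⁻¹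

/-- `u : ℤ → ℝ` is `N`-periodic. -/
def IsPeriodic (N : ℕ) (u : ℤ → ℝ) : Prop := ∀ ξ : ℤ, u (ξ + N) = u ξ

/-- Membership in the space `𝒰` of `N`-periodic mean-zero displacements. -/
def inU (N : ℕ) (u : ℤ → ℝ) : Prop :=
  IsPeriodic N u ∧ ∑ ξ ∈ Finset.Icc (1 : ℤ) (N : ℤ), u ξ = 0

/-- The uniform deformation `y^F_ξ = F ε ξ`. -/
def yUnif (N : ℕ) (F : ℝ) : ℤ → ℝ := fun ξ => F * eps N * ξ

/-- Membership in the space `𝒴` of admissible deformations. -/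
def inY (N : ℕ) (y : ℤ → ℝ) : Prop :=
  ∃ F : ℝ, 0 < F ∧ ∃ u : ℤ → ℝ, inU N u ∧ y = fun ξ => yUnif N F ξ + u ξ

/-- The discrete first derivative `y'_ξ = (y_ξ - y_{ξ-1})/ε`. -/
def d1 (N : ℕ) (y : ℤ → ℝ) (ξ : ℤ) : ℝ := (y ξ - y (ξ - 1)) / eps N

/-- The discrete second derivative `y''_ξ`. -/
def d2 (N : ℕ) (y : ℤ → ℝ) (ξ : ℤ) : ℝ :=
  (y (ξ + 1) - 2 * y ξ + y (ξ - 1)) / (eps N) ^ 2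

/-- The discrete third derivative `y'''_ξ`. -/
def d3 (N : ℕ) (y : ℤ → ℝ) (ξ : ℤ) : ℝ :=
  (y (ξ + 1) - 3 * y ξ + 3 * y (ξ - 1) - y (ξ - 2)) / (eps N) ^ 3

/-- The BQC energy `Φ_{α,β}`. -/
def PhiBQC (N : ℕ) (φ : ℝ → ℝ) (α β : ℤ → ℝ) (y : ℤ → ℝ) : ℝ :=
  eps N * ∑ ξ ∈ Finset.Icc (1 : ℤ) (N : ℤ),
    (φ (d1 N y ξ) + α ξ * φ (2 * d1 N y ξ) + β ξ * φ (d1 N y ξ + d1 N y (ξ + 1)))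

/-- The BQNL energy with blending function `η`. -/
def PhiBQNL (N : ℕ) (φ : ℝ → ℝ) (η : ℤ → ℝ) : (ℤ → ℝ) → ℝ :=
  PhiBQC N φ (fun ξ => 1 - (η ξ + η (ξ - 1)) / 2) η

/-- The BQCE energy with blending function `γ`. -/
def PhiBQCE (N : ℕ) (φ : ℝ → ℝ) (γ : ℤ → ℝ) : (ℤ → ℝ) → ℝ :=
  PhiBQC N φ (fun ξ => (γ ξ + γ (ξ - 1)) / 2) (fun ξ => 1 - (γ (ξ + 1) + γ (ξ - 1)) / 2)

/-- The atomistic energy `Φ`. -/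
def PhiAt (N : ℕ) (φ : ℝ → ℝ) (y : ℤ → ℝ) : ℝ :=
  eps N * ∑ ξ ∈ Finset.Icc (1 : ℤ) (N : ℤ),
    (φ (d1 N y ξ) + φ (d1 N y ξ + d1 N y (ξ + 1)))

/-- The first variation `δΨ(y)[u] = (d/dt)|_{t=0} Ψ(y+tu)`. -/
def fvar (Ψ : (ℤ → ℝ) → ℝ) (y u : ℤ → ℝ) : ℝ :=
  deriv (fun t : ℝ => Ψ (fun ξ => y ξ + t * u ξ)) 0

/-- The second variation `δ²Ψ(y)[u,u] = (d²/dt²)|_{t=0} Ψ(y+tu)`. -/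
def svar (Ψ : (ℤ → ℝ) → ℝ) (y u : ℤ → ℝ) : ℝ :=
  iteratedDeriv 2 (fun t : ℝ => Ψ (fun ξ => y ξ + t * u ξ)) 0

/-- `max_ξ |v_ξ|` (for a periodic sequence this is a genuine maximum). -/
def supAbs (v : ℤ → ℝ) : ℝ := sSup (Set.range fun ξ => |v ξ|)

/-- `min_ξ y'_ξ` (for an admissible deformation this is a genuine minimum). -/
def infD1 (N : ℕ) (y : ℤ → ℝ) : ℝ := sInf (Set.range fun ξ => d1 N y ξ)

/-- The constant `C_i(r₀) = sup_{r ≥ r₀} |φ^(i)(r)|`. -/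
def Cbound (φ : ℝ → ℝ) (i : ℕ) (r₀ : ℝ) : ℝ :=
  sSup ((fun r => |iteratedDeriv i φ r|) '' Set.Ici r₀)

/-- The `ℓ^p_ε` norm over one period, `p ∈ [1,∞]`. -/
def lpnorm (N : ℕ) (p : ℝ≥0∞) (v : ℤ → ℝ) : ℝ :=
  if p = ⊤ then supAbs v
  else (eps N * ∑ ξ ∈ Finset.Icc (1 : ℤ) (N : ℤ), |v ξ| ^ p.toReal) ^ (1 / p.toReal)

/-- The Hessian coefficient `A_ξ` of the atomistic energy. -/
def Acoef (N : ℕ) (φ : ℝ → ℝ) (y : ℤ → ℝ) (ξ : ℤ) : ℝ :=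
  iteratedDeriv 2 φ (d1 N y ξ) + 2 * iteratedDeriv 2 φ (d1 N y ξ + d1 N y (ξ + 1))
    + 2 * iteratedDeriv 2 φ (d1 N y (ξ - 1) + d1 N y ξ)

/-- The Hessian coefficient `Ā_ξ` of the BQC energy. -/
def AbarCoef (N : ℕ) (φ : ℝ → ℝ) (α β : ℤ → ℝ) (y : ℤ → ℝ) (ξ : ℤ) : ℝ :=
  iteratedDeriv 2 φ (d1 N y ξ) + 2 * β ξ * iteratedDeriv 2 φ (d1 N y ξ + d1 N y (ξ + 1))
    + 2 * β (ξ - 1) * iteratedDeriv 2 φ (d1 N y (ξ - 1) + d1 N y ξ)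
    + 4 * α ξ * iteratedDeriv 2 φ (2 * d1 N y ξ)

/-- The coercivity constant `inf { δ²Ψ(y)[u,u] : u ∈ 𝒰, ‖u'‖_{ℓ²_ε} = 1 }`. -/
def coercConst (N : ℕ) (Ψ : (ℤ → ℝ) → ℝ) (y : ℤ → ℝ) : ℝ :=
  sInf { c : ℝ | ∃ u : ℤ → ℝ, inU N u ∧ lpnorm N 2 (d1 N u) = 1 ∧ c = svar Ψ y u }

end

section Calculus

variable {φ : ℝ → ℝ}

theorem hasDerivAt_iteratedDeriv_of_contDiffOn {n k : ℕ} {s : Set ℝ} (hs : IsOpen s)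
    (hφ : ContDiffOn ℝ n φ s) (hk : k < n) {r : ℝ} (hr : r ∈ s) :
    HasDerivAt (iteratedDeriv k φ) (iteratedDeriv (k + 1) φ r) r := by
  rw [iteratedDeriv_succ]
  refine DifferentiableAt.hasDerivAt ?_
  have h := (hφ.differentiableOn_iteratedDerivWithin (m := k) (by exact_mod_cast hk)
    hs.uniqueDiffOn) r hr
  have heq : Set.EqOn (iteratedDeriv k φ) (iteratedDerivWithin k φ s) s :=
    fun x hx => (iteratedDerivWithin_of_isOpen hs hx).symm
  exact (h.congr heq (heq hr)).differentiableAt (hs.mem_nhds hr)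

/-- The second derivative of `φ` along the line `t ↦ a + t b`. -/
theorem iteratedDeriv_two_comp_line (hφ : ContDiffOn ℝ 4 φ (Set.Ioi 0)) {a : ℝ} (ha : 0 < a)
    (b : ℝ) :
    iteratedDeriv 2 (fun t : ℝ => φ (a + t * b)) 0 = iteratedDeriv 2 φ a * b ^ 2 := by
  have hline : ∀ t : ℝ, HasDerivAt (fun t : ℝ => a + t * b) b t := fun t => by
    simpa using ((hasDerivAt_id t).mul_const b).const_add a
  have hpos : ∀ᶠ t : ℝ in nhds 0, 0 < a + t * b := by
    refine (hline 0).continuousAt.eventually_const_lt ?_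
    simpa using ha
  have hφ' : ContDiffOn ℝ (4 : ℕ) φ (Set.Ioi 0) := by exact_mod_cast hφ
  have hderiv : deriv (fun t : ℝ => φ (a + t * b)) =ᶠ[nhds 0]
      fun t => iteratedDeriv 1 φ (a + t * b) * b := by
    filter_upwards [hpos] with t ht
    have h := hasDerivAt_iteratedDeriv_of_contDiffOn (k := 0) isOpen_Ioi hφ' (by norm_num) ht
    rw [iteratedDeriv_zero] at h
    exact (h.comp t (hline t)).deriv
  have hsecond : HasDerivAt (fun t : ℝ => iteratedDeriv 1 φ (a + t * b) * b)
      (iteratedDeriv 2 φ (a + 0 * b) * b * b) 0 := by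
    have h := hasDerivAt_iteratedDeriv_of_contDiffOn (k := 1) isOpen_Ioi hφ' (by norm_num)
      (Set.mem_Ioi.2 hpos.self_of_nhds)
    exact (h.comp (0 : ℝ) (hline 0)).mul_const b
  rw [iteratedDeriv_succ, iteratedDeriv_one, hderiv.deriv_eq, hsecond.deriv, zero_mul, add_zero]
  ring

/-- First-order Taylor estimate on a convex set, with a bound on the second derivative. -/
theorem abs_taylor_one_remainder_le {f f' f'' : ℝ → ℝ} {s : Set ℝ} (hs : Convex ℝ s) {C : ℝ}
    (hf : ∀ r ∈ s, HasDerivAt f (f' r) r) (hf' : ∀ r ∈ s, HasDerivAt f' (f'' r) r)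
    (hC : ∀ r ∈ s, |f'' r| ≤ C) {x h : ℝ} (hx : x ∈ s) (hxh : x + h ∈ s) :
    |f (x + h) - f x - f' x * h| ≤ C * h ^ 2 / 2 := by
  have hmem : ∀ t ∈ Set.Icc (0 : ℝ) 1, x + t * h ∈ s := fun t ht => by
    simpa [smul_eq_mul] using hs.add_smul_mem hx hxh ht
  have hline : ∀ t : ℝ, HasDerivAt (fun t : ℝ => x + t * h) h t := fun t => by
    simpa using ((hasDerivAt_id t).mul_const h).const_add x
  have hg : ∀ t ∈ Set.Icc (0 : ℝ) 1,
      HasDerivAt (fun t => f (x + t * h) - f x - t * (f' x * h))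
        (f' (x + t * h) * h - f' x * h) t := fun t ht => by
    refine ((((hf _ (hmem t ht)).comp t (hline t)).sub_const (f x)).sub
      ((hasDerivAt_id t).mul_const (f' x * h))).congr_deriv ?_
    rw [one_mul]
  have hB : ∀ t : ℝ, HasDerivAt (fun t : ℝ => C * h ^ 2 / 2 * t ^ 2) (C * h ^ 2 * t) t :=
    fun t => by
      refine ((hasDerivAt_pow 2 t).const_mul (C * h ^ 2 / 2)).congr_deriv ?_
      norm_num
      ring
  have key := image_norm_le_of_norm_deriv_right_le_deriv_boundary
    (fun t ht => (hg t ht).continuousAt.continuousWithinAt)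
    (fun t ht => (hg t (Set.Ico_subset_Icc_self ht)).hasDerivWithinAt)
    (by simp) hB
    (fun t ht => by
      have hlip := hs.norm_image_sub_le_of_norm_hasDerivWithin_le
        (fun r hr => (hf' r hr).hasDerivWithinAt) hC hx (hmem t (Set.Ico_subset_Icc_self ht))
      simp only [Real.norm_eq_abs, add_sub_cancel_left, abs_mul, abs_of_nonneg ht.1] at hlip
      rw [← sub_mul, Real.norm_eq_abs, abs_mul]
      calc |f' (x + t * h) - f' x| * |h| ≤ C * (t * |h|) * |h| := by gcongr
        _ = C * |h| ^ 2 * t := by ring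
        _ = C * h ^ 2 * t := by rw [sq_abs])
    (Set.right_mem_Icc.2 zero_le_one)
  simpa [mul_comm h] using key

end Calculus

section Periodic

theorem eps_pos {N : ℕ} (hN : 0 < N) : 0 < eps N := inv_pos.2 (by exact_mod_cast hN)

theorem IsPeriodic.abs_le_supAbs {N : ℕ} (hN : 0 < N) {v : ℤ → ℝ} (hv : IsPeriodic N v)
    (ξ : ℤ) : |v ξ| ≤ supAbs v := by
  have hper : Function.Periodic (fun ξ => |v ξ|) (N : ℤ) := fun ξ => by simp only [hv ξ]
  have hfin : (Set.range fun ξ => |v ξ|).Finite := by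
    rw [← hper.image_Ioc (by exact_mod_cast hN) 0]
    exact (Set.finite_Ioc _ _).image _
  exact le_csSup hfin.bddAbove ⟨ξ, rfl⟩

theorem supAbs_nonneg (v : ℤ → ℝ) : 0 ≤ supAbs v :=
  Real.sSup_nonneg (by rintro _ ⟨ξ, rfl⟩; exact abs_nonneg _)

theorem Cbound_nonneg (φ : ℝ → ℝ) (i : ℕ) (r : ℝ) : 0 ≤ Cbound φ i r :=
  Real.sSup_nonneg (by rintro _ ⟨ξ, _, rfl⟩; exact abs_nonneg _)

theorem sum_Icc_sub_shift (f : ℤ → ℝ) (n : ℕ) :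
    ∑ ξ ∈ Finset.Icc (1 : ℤ) n, (f ξ - f (ξ - 1)) = f n - f 0 := by
  induction n with
  | zero => simp
  | succ n ih =>
    have hIcc : Finset.Icc (1 : ℤ) ((n + 1 : ℕ) : ℤ)
        = insert ((n : ℤ) + 1) (Finset.Icc (1 : ℤ) n) := by
      ext x
      simp only [Finset.mem_Icc, Finset.mem_insert]
      push_cast
      omega
    rw [hIcc, Finset.sum_insert (by simp), ih]
    push_cast
    simp

theorem IsPeriodic.sum_shift {N : ℕ} {f : ℤ → ℝ} (hf : IsPeriodic N f) :
    ∑ ξ ∈ Finset.Icc (1 : ℤ) N, f (ξ - 1) = ∑ ξ ∈ Finset.Icc (1 : ℤ) N, f ξ := by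
  have h := sum_Icc_sub_shift f N
  have h0 : f N = f 0 := by simpa using hf 0
  rw [Finset.sum_sub_distrib, h0] at h
  linarith

theorem IsPeriodic.d1 {N : ℕ} {u : ℤ → ℝ} (hu : IsPeriodic N u) : IsPeriodic N (d1 N u) := by
  intro ξ
  have h : ξ + (N : ℤ) - 1 = ξ - 1 + N := by ring
  simp only [_root_.d1, hu ξ, h, hu (ξ - 1)]

theorem inY.d1_periodic {N : ℕ} {y : ℤ → ℝ} (hy : inY N y) : IsPeriodic N (d1 N y) := by
  obtain ⟨F, -, u, hu, rfl⟩ := hy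
  intro ξ
  have h := hu.1.d1 ξ
  simp only [d1, yUnif] at h ⊢
  have hsplit : ∀ a b c d e : ℝ, (a + b - (c + d)) / e = (a - c) / e + (b - d) / e := by
    intros
    ring
  rw [hsplit, hsplit, h]
  push_cast
  ring

theorem eps_mul_d2 {N : ℕ} (hN : 0 < N) (y : ℤ → ℝ) (ξ : ℤ) :
    eps N * d2 N y ξ = d1 N y (ξ + 1) - d1 N y ξ := by
  have h := (eps_pos hN).ne'
  simp only [d1, d2, add_sub_cancel_right]
  field_simp
  ring

theorem eps_mul_d3 {N : ℕ} (hN : 0 < N) (y : ℤ → ℝ) (ξ : ℤ) :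
    eps N * d3 N y ξ = d2 N y ξ - d2 N y (ξ - 1) := by
  have h := (eps_pos hN).ne'
  have h2 : ξ - 1 - 1 = ξ - 2 := by ring
  simp only [d2, d3, sub_add_cancel, h2]
  field_simp
  ring

theorem inY.d2_periodic {N : ℕ} (hN : 0 < N) {y : ℤ → ℝ} (hy : inY N y) :
    IsPeriodic N (d2 N y) := by
  intro ξ
  apply mul_left_cancel₀ (eps_pos hN).ne'
  rw [eps_mul_d2 hN, eps_mul_d2 hN, add_right_comm, hy.d1_periodic, hy.d1_periodic]

theorem inY.d3_periodic {N : ℕ} (hN : 0 < N) {y : ℤ → ℝ} (hy : inY N y) :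
    IsPeriodic N (d3 N y) := by
  intro ξ
  apply mul_left_cancel₀ (eps_pos hN).ne'
  rw [eps_mul_d3 hN, eps_mul_d3 hN, add_sub_right_comm, hy.d2_periodic hN, hy.d2_periodic hN]

theorem infD1_le {N : ℕ} {y : ℤ → ℝ} (h : 0 < infD1 N y) (ξ : ℤ) : infD1 N y ≤ d1 N y ξ := by
  refine csInf_le ?_ ⟨ξ, rfl⟩
  by_contra hb
  rw [infD1, Real.sInf_of_not_bddBelow hb] at h
  exact h.false

theorem eps_mul_sum_sq_eq_one {N : ℕ} {v : ℤ → ℝ} (h : lpnorm N 2 v = 1) :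
    eps N * ∑ ξ ∈ Finset.Icc (1 : ℤ) N, v ξ ^ 2 = 1 := by
  simp only [lpnorm, ENNReal.ofNat_ne_top, if_false, ENNReal.toReal_ofNat, Real.rpow_ofNat,
    sq_abs, ← Real.sqrt_eq_rpow, Real.sqrt_eq_one] at h
  exact h

end Periodic

section Hessian

/-- The second variation of the BQC energy. -/
theorem svar_PhiBQC {N : ℕ} {φ : ℝ → ℝ} (hφ : ContDiffOn ℝ 4 φ (Set.Ioi 0)) (α β : ℤ → ℝ)
    {y : ℤ → ℝ} (hy : ∀ ξ, 0 < d1 N y ξ) (u : ℤ → ℝ) :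
    svar (PhiBQC N φ α β) y u = eps N * ∑ ξ ∈ Finset.Icc (1 : ℤ) N,
      (iteratedDeriv 2 φ (d1 N y ξ) * d1 N u ξ ^ 2
        + α ξ * (iteratedDeriv 2 φ (2 * d1 N y ξ) * (2 * d1 N u ξ) ^ 2)
        + β ξ * (iteratedDeriv 2 φ (d1 N y ξ + d1 N y (ξ + 1))
          * (d1 N u ξ + d1 N u (ξ + 1)) ^ 2)) := by
  have hd : ∀ (t : ℝ) (ξ : ℤ), d1 N (fun ξ => y ξ + t * u ξ) ξ = d1 N y ξ + t * d1 N u ξ := by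
    intro t ξ
    simp only [d1]
    ring
  have h2 : ∀ (t : ℝ) (ξ : ℤ),
      2 * (d1 N y ξ + t * d1 N u ξ) = 2 * d1 N y ξ + t * (2 * d1 N u ξ) := by
    intros
    ring
  have h3 : ∀ (t : ℝ) (ξ : ℤ),
      d1 N y ξ + t * d1 N u ξ + (d1 N y (ξ + 1) + t * d1 N u (ξ + 1))
        = d1 N y ξ + d1 N y (ξ + 1) + t * (d1 N u ξ + d1 N u (ξ + 1)) := by
    intros
    ring
  have hsmooth : ∀ a b : ℝ, 0 < a → ContDiffAt ℝ 2 (fun t : ℝ => φ (a + t * b)) 0 := by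
    intro a b ha
    have hφa : ContDiffAt ℝ 2 φ (a + 0 * b) :=
      (hφ.contDiffAt (isOpen_Ioi.mem_nhds (by simpa using ha))).of_le (by norm_num)
    exact hφa.comp (0 : ℝ) (by fun_prop)
  have hs1 := fun ξ => hsmooth _ (d1 N u ξ) (hy ξ)
  have hs2 := fun ξ => hsmooth _ (2 * d1 N u ξ) (mul_pos two_pos (hy ξ))
  have hs3 := fun ξ => hsmooth _ (d1 N u ξ + d1 N u (ξ + 1)) (add_pos (hy ξ) (hy (ξ + 1)))
  simp only [svar, PhiBQC, hd, h2, h3]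
  rw [iteratedDeriv_const_mul_field, iteratedDeriv_fun_sum]
  · congr 1
    refine Finset.sum_congr rfl fun ξ _ => ?_
    rw [iteratedDeriv_fun_add ((hs1 ξ).add (contDiffAt_const.mul (hs2 ξ)))
        (contDiffAt_const.mul (hs3 ξ)),
      iteratedDeriv_fun_add (hs1 ξ) (contDiffAt_const.mul (hs2 ξ)),
      iteratedDeriv_const_mul_field, iteratedDeriv_const_mul_field,
      iteratedDeriv_two_comp_line hφ (hy ξ),
      iteratedDeriv_two_comp_line hφ (mul_pos two_pos (hy ξ)),
      iteratedDeriv_two_comp_line hφ (add_pos (hy ξ) (hy (ξ + 1)))]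
  · exact fun ξ _ => ((hs1 ξ).add (contDiffAt_const.mul (hs2 ξ))).add
      (contDiffAt_const.mul (hs3 ξ))

theorem PhiAt_eq_PhiBQC (N : ℕ) (φ : ℝ → ℝ) :
    PhiAt N φ = PhiBQC N φ (fun _ => 0) (fun _ => 1) := by
  funext y
  simp [PhiAt, PhiBQC]

/-- The BQC Hessian is bounded below on the unit sphere of the discrete `H¹` seminorm. -/
theorem neg_le_svar_PhiBQC {N : ℕ} (hN : 0 < N) {φ : ℝ → ℝ}
    (hφ : ContDiffOn ℝ 4 φ (Set.Ioi 0)) {α β : ℤ → ℝ}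
    (hα : ∀ ξ, α ξ ∈ Set.Icc (0 : ℝ) 1) (hβ : ∀ ξ, β ξ ∈ Set.Icc (0 : ℝ) 1)
    {y : ℤ → ℝ} {m K : ℝ} (hm : 0 < m) (hy : ∀ ξ, m ≤ d1 N y ξ)
    (hK : ∀ r, m ≤ r → |iteratedDeriv 2 φ r| ≤ K) {u : ℤ → ℝ} (hu : inU N u)
    (hnorm : lpnorm N 2 (d1 N u) = 1) :
    -(9 * K) ≤ svar (PhiBQC N φ α β) y u := by
  have hv := eps_mul_sum_sq_eq_one hnorm
  rw [svar_PhiBQC hφ α β (fun ξ => hm.trans_le (hy ξ))]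
  have hK0 : 0 ≤ K := (abs_nonneg _).trans (hK m le_rfl)
  have hper : IsPeriodic N (fun ξ => d1 N u (ξ + 1) ^ 2) := fun ξ => by
    simp only [add_right_comm ξ (N : ℤ) 1, hu.1.d1 (ξ + 1)]
  have hshift := hper.sum_shift
  simp only [sub_add_cancel] at hshift
  have hle : ∀ ξ ∈ Finset.Icc (1 : ℤ) N,
      -(7 * K) * d1 N u ξ ^ 2 - 2 * K * d1 N u (ξ + 1) ^ 2 ≤
      iteratedDeriv 2 φ (d1 N y ξ) * d1 N u ξ ^ 2
        + α ξ * (iteratedDeriv 2 φ (2 * d1 N y ξ) * (2 * d1 N u ξ) ^ 2)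
        + β ξ * (iteratedDeriv 2 φ (d1 N y ξ + d1 N y (ξ + 1))
          * (d1 N u ξ + d1 N u (ξ + 1)) ^ 2) := by
    intro ξ _
    have hweighted : ∀ {w p z : ℝ}, w ∈ Set.Icc (0 : ℝ) 1 → |p| ≤ K →
        -(K * z ^ 2) ≤ w * (p * z ^ 2) := by
      intro w p z hw hp
      have h1 : -K ≤ w * p := by
        have := (abs_le.1 hp).1
        nlinarith [hw.1, hw.2]
      nlinarith [mul_le_mul_of_nonneg_right h1 (sq_nonneg z)]
    have hy1 := hy ξ
    have hy2 := hy (ξ + 1)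
    have e1 := hweighted (z := d1 N u ξ) (w := 1) (by simp) (hK _ hy1)
    have e2 := hweighted (z := 2 * d1 N u ξ) (hα ξ) (hK (2 * d1 N y ξ) (by linarith))
    have e3 := hweighted (z := d1 N u ξ + d1 N u (ξ + 1)) (hβ ξ)
      (hK (d1 N y ξ + d1 N y (ξ + 1)) (by linarith))
    nlinarith [mul_nonneg hK0 (sq_nonneg (d1 N u ξ - d1 N u (ξ + 1)))]
  have hsum := Finset.sum_le_sum hle
  rw [Finset.sum_sub_distrib, ← Finset.mul_sum, ← Finset.mul_sum, ← hshift] at hsum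
  have := mul_le_mul_of_nonneg_left hsum (eps_pos hN).le
  nlinarith

/-- The local consistency estimate for the Hessian coefficients, given first-order Taylor
expansions of the second-neighbour stiffnesses `q₁`, `q₀` around `p`. -/
theorem abs_weighted_stiffness_error_le {e p q₁ q₀ t h₁ h₀ d b₁ b₀ C₃ C₄ M₁ M₂ M₃ : ℝ}
    (he : 0 < e) (hb₁ : b₁ ≤ 1) (hb₀ : b₀ ≤ 1) (ht : |t| ≤ C₃) (hC₄ : 0 ≤ C₄)
    (hq₁ : |q₁ - p - t * (e * h₁)| ≤ C₄ * (e * h₁) ^ 2 / 2)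
    (hq₀ : |q₀ - p - t * (-(e * h₀))| ≤ C₄ * (-(e * h₀)) ^ 2 / 2)
    (hd : e * d = h₁ - h₀) (hM₁ : |(b₁ - b₀) * h₁| ≤ M₁) (hM₂ : |(1 - b₀) * d| ≤ M₂)
    (hM₃ : |(1 - b₁) * h₁ ^ 2| ≤ M₃) (hM₃' : |(1 - b₀) * h₀ ^ 2| ≤ M₃) :
    |(1 - b₁) * (q₁ - p) + (1 - b₀) * (q₀ - p)|
      ≤ e * C₃ * M₁ + e ^ 2 * (C₃ * M₂ + C₄ * M₃) := by
  have hC₃ : 0 ≤ C₃ := (abs_nonneg t).trans ht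
  have hsplit : (1 - b₁) * (q₁ - p) + (1 - b₀) * (q₀ - p)
      = -(e * (t * ((b₁ - b₀) * h₁))) + e ^ 2 * (t * ((1 - b₀) * d))
        + ((1 - b₁) * (q₁ - p - t * (e * h₁)) + (1 - b₀) * (q₀ - p - t * (-(e * h₀)))) := by
    have : h₀ = h₁ - e * d := by linarith
    subst this
    ring
  have hrem : ∀ {b q h : ℝ}, b ≤ 1 → |q| ≤ C₄ * h ^ 2 * e ^ 2 / 2 → |(1 - b) * h ^ 2| ≤ M₃ →
      |(1 - b) * q| ≤ e ^ 2 * (C₄ * M₃) / 2 := by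
    intro b q h hb hq hM
    rw [abs_mul, abs_of_nonneg (sub_nonneg.2 hb)]
    calc (1 - b) * |q| ≤ (1 - b) * (C₄ * h ^ 2 * e ^ 2 / 2) :=
          mul_le_mul_of_nonneg_left hq (sub_nonneg.2 hb)
      _ = e ^ 2 * (C₄ * ((1 - b) * h ^ 2)) / 2 := by ring
      _ ≤ e ^ 2 * (C₄ * M₃) / 2 := by
        have := (le_abs_self _).trans hM
        gcongr
  have r₁ := hrem hb₁ (hq₁.trans_eq (by ring)) hM₃
  have r₀ := hrem hb₀ (hq₀.trans_eq (by ring)) hM₃'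
  have s₁ : |-(e * (t * ((b₁ - b₀) * h₁)))| ≤ e * (C₃ * M₁) := by
    rw [abs_neg, abs_mul, abs_mul t, abs_of_pos he]
    gcongr
  have s₂ : |e ^ 2 * (t * ((1 - b₀) * d))| ≤ e ^ 2 * (C₃ * M₂) := by
    rw [abs_mul, abs_mul t, abs_of_pos (pow_pos he 2)]
    gcongr
  rw [hsplit]
  refine (abs_add_le _ _).trans ?_
  have t₁ := abs_add_le (-(e * (t * ((b₁ - b₀) * h₁)))) (e ^ 2 * (t * ((1 - b₀) * d)))
  have t₂ := abs_add_le ((1 - b₁) * (q₁ - p - t * (e * h₁)))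
    ((1 - b₀) * (q₀ - p - t * (-(e * h₀))))
  linarith

/-- Comparison of the atomistic and BQNL Hessians when second-neighbour bonds are concave. -/
theorem svar_PhiBQNL_sub_le {N : ℕ} (hN : 0 < N) {φ : ℝ → ℝ}
    (hφ : ContDiffOn ℝ 4 φ (Set.Ioi 0)) {η : ℤ → ℝ} (hηper : IsPeriodic N η)
    (hη1 : ∀ ξ, η ξ ≤ 1) {y : ℤ → ℝ} (hyper : IsPeriodic N (d1 N y))
    (hypos : ∀ ξ, 0 < d1 N y ξ)
    (hneg : ∀ ξ, iteratedDeriv 2 φ (d1 N y ξ + d1 N y (ξ + 1)) ≤ 0) {E : ℝ}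
    (hE : ∀ ξ, |(1 - η ξ) * (iteratedDeriv 2 φ (d1 N y ξ + d1 N y (ξ + 1))
          - iteratedDeriv 2 φ (2 * d1 N y ξ))
        + (1 - η (ξ - 1)) * (iteratedDeriv 2 φ (d1 N y (ξ - 1) + d1 N y ξ)
          - iteratedDeriv 2 φ (2 * d1 N y ξ))| ≤ E)
    {u : ℤ → ℝ} (hu : inU N u) (hnorm : lpnorm N 2 (d1 N u) = 1) :
    svar (PhiBQNL N φ η) y u - 2 * E ≤ svar (PhiAt N φ) y u := by
  have hv := eps_mul_sum_sq_eq_one hnorm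
  rw [PhiAt_eq_PhiBQC, PhiBQNL, svar_PhiBQC hφ _ _ hypos, svar_PhiBQC hφ _ _ hypos]
  set v := d1 N u with hvdef
  set g : ℤ → ℝ := fun ξ =>
    2 * (1 - η ξ) * iteratedDeriv 2 φ (d1 N y ξ + d1 N y (ξ + 1)) * v (ξ + 1) ^ 2 with hg
  have hgper : IsPeriodic N g := fun ξ => by
    simp only [hg, add_right_comm ξ (N : ℤ) 1, hηper ξ, hyper ξ, hyper (ξ + 1), hvdef,
      hu.1.d1 (ξ + 1)]
  have hshift := hgper.sum_shift
  have hle : ∀ ξ ∈ Finset.Icc (1 : ℤ) N,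
      (iteratedDeriv 2 φ (d1 N y ξ) * v ξ ^ 2
        + (1 - (η ξ + η (ξ - 1)) / 2) * (iteratedDeriv 2 φ (2 * d1 N y ξ) * (2 * v ξ) ^ 2)
        + η ξ * (iteratedDeriv 2 φ (d1 N y ξ + d1 N y (ξ + 1)) * (v ξ + v (ξ + 1)) ^ 2))
        - 2 * E * v ξ ^ 2 + (g ξ - g (ξ - 1))
      ≤ iteratedDeriv 2 φ (d1 N y ξ) * v ξ ^ 2
        + 0 * (iteratedDeriv 2 φ (2 * d1 N y ξ) * (2 * v ξ) ^ 2)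
        + 1 * (iteratedDeriv 2 φ (d1 N y ξ + d1 N y (ξ + 1)) * (v ξ + v (ξ + 1)) ^ 2) := by
    intro ξ _
    have h1 := mul_le_mul_of_nonneg_right (neg_le_of_abs_le (hE ξ)) (sq_nonneg (v ξ))
    have h2 : (1 - η ξ) * iteratedDeriv 2 φ (d1 N y ξ + d1 N y (ξ + 1))
        * (v ξ - v (ξ + 1)) ^ 2 ≤ 0 :=
      mul_nonpos_of_nonpos_of_nonneg
        (mul_nonpos_of_nonneg_of_nonpos (sub_nonneg.2 (hη1 ξ)) (hneg ξ)) (sq_nonneg _)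
    simp only [hg, sub_add_cancel]
    linarith
  have hsum := Finset.sum_le_sum hle
  rw [Finset.sum_add_distrib, Finset.sum_sub_distrib, Finset.sum_sub_distrib, hshift, sub_self,
    add_zero, ← Finset.mul_sum] at hsum
  have hscaled := mul_le_mul_of_nonneg_left hsum (eps_pos hN).le
  rw [mul_sub, mul_left_comm (eps N) (2 * E), hv, mul_one] at hscaled
  exact hscaled

end Hessian

/-- A posteriori stability of BQNL. -/
theorem aposteriori_stability_bqnl
    (N : ℕ) (hN : 5 ≤ N) (φ : ℝ → ℝ) (hφ : ContDiffOn ℝ 4 φ (Set.Ioi 0))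
    (hC : ∀ i ≤ 4, ∀ r₀ : ℝ, 0 < r₀ →
      BddAbove ((fun r => |iteratedDeriv i φ r|) '' Set.Ici r₀))
    (rstar : ℝ) (hrstar : 0 < rstar)
    (hconvex : ∀ r : ℝ, 0 < r → r < rstar → 0 < iteratedDeriv 2 φ r)
    (hconcave : ∀ r : ℝ, rstar < r → iteratedDeriv 2 φ r < 0)
    (η : ℤ → ℝ) (hηper : IsPeriodic N η) (hη01 : ∀ ξ, η ξ ∈ Set.Icc (0 : ℝ) 1)
    (β : ℤ → ℝ) (hβ : β = η)
    (y : ℤ → ℝ) (hy : inY N y) (hy' : rstar / 2 ≤ infD1 N y) :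
    coercConst N (PhiBQNL N φ η) y
        - 2 * eps N * Cbound φ 3 (2 * infD1 N y) *
            supAbs (fun ξ => (β ξ - β (ξ - 1)) * d2 N y ξ)
        - 2 * (eps N) ^ 2 *
            (Cbound φ 3 (2 * infD1 N y) * supAbs (fun ξ => (1 - β (ξ - 1)) * d3 N y ξ)
              + Cbound φ 4 (2 * infD1 N y) *
                  supAbs (fun ξ => (1 - β ξ) * (d2 N y ξ) ^ 2))
      ≤ coercConst N (PhiAt N φ) y := by
  subst hβ
  have hN0 : 0 < N := by omega
  have hε := eps_pos hN0
  set m := infD1 N y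
  have hm0 : 0 < m := by linarith
  have hym : ∀ ξ, m ≤ d1 N y ξ := infD1_le hm0
  have hle : ∀ i ≤ 4, ∀ r₀ : ℝ, 0 < r₀ → ∀ r ∈ Set.Ici r₀,
      |iteratedDeriv i φ r| ≤ Cbound φ i r₀ :=
    fun i hi r₀ h0 r hr => le_csSup (hC i hi r₀ h0) ⟨r, hr, rfl⟩
  have hφ' : ContDiffOn ℝ (4 : ℕ) φ (Set.Ioi 0) := by exact_mod_cast hφ
  have hder : ∀ k < 4, ∀ r : ℝ, 0 < r →
      HasDerivAt (iteratedDeriv k φ) (iteratedDeriv (k + 1) φ r) r :=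
    fun k hk r hr => hasDerivAt_iteratedDeriv_of_contDiffOn isOpen_Ioi hφ' hk hr
  have hnonpos : ∀ r, rstar ≤ r → iteratedDeriv 2 φ r ≤ 0 := by
    intro r hr
    rcases hr.eq_or_lt with rfl | hlt
    · have hcont := (hder 2 (by norm_num) rstar hrstar).continuousAt.tendsto.mono_left
        (nhdsWithin_le_nhds (s := Set.Ioi rstar))
      refine le_of_tendsto hcont ?_
      filter_upwards [self_mem_nhdsWithin] with r hr using (hconcave r hr).le
    · exact (hconcave r hlt).le
  have h2m : 0 < 2 * m := by linarith
  set C₃ := Cbound φ 3 (2 * m)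
  set C₄ := Cbound φ 4 (2 * m)
  have hC₃0 : 0 ≤ C₃ := Cbound_nonneg _ _ _
  have hC₄0 : 0 ≤ C₄ := Cbound_nonneg _ _ _
  set M₁ := supAbs (fun ξ => (β ξ - β (ξ - 1)) * d2 N y ξ) with hM₁
  set M₂ := supAbs (fun ξ => (1 - β (ξ - 1)) * d3 N y ξ) with hM₂
  set M₃ := supAbs (fun ξ => (1 - β ξ) * (d2 N y ξ) ^ 2) with hM₃
  have hM₁0 : 0 ≤ M₁ := supAbs_nonneg _
  have hM₂0 : 0 ≤ M₂ := supAbs_nonneg _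
  have hM₃0 : 0 ≤ M₃ := supAbs_nonneg _
  have hM₁le : ∀ ξ, |(β ξ - β (ξ - 1)) * d2 N y ξ| ≤ M₁ :=
    IsPeriodic.abs_le_supAbs (v := fun ξ => (β ξ - β (ξ - 1)) * d2 N y ξ) hN0 fun ξ => by
      simp only [add_sub_right_comm ξ (N : ℤ) 1, hηper ξ, hηper (ξ - 1), hy.d2_periodic hN0 ξ]
  have hM₂le : ∀ ξ, |(1 - β (ξ - 1)) * d3 N y ξ| ≤ M₂ :=
    IsPeriodic.abs_le_supAbs (v := fun ξ => (1 - β (ξ - 1)) * d3 N y ξ) hN0 fun ξ => by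
      simp only [add_sub_right_comm ξ (N : ℤ) 1, hηper (ξ - 1), hy.d3_periodic hN0 ξ]
  have hM₃le : ∀ ξ, |(1 - β ξ) * d2 N y ξ ^ 2| ≤ M₃ :=
    IsPeriodic.abs_le_supAbs (v := fun ξ => (1 - β ξ) * d2 N y ξ ^ 2) hN0 fun ξ => by
      simp only [hηper ξ, hy.d2_periodic hN0 ξ]
  have htaylor : ∀ x h : ℝ, 2 * m ≤ x → 2 * m ≤ x + h →
      |iteratedDeriv 2 φ (x + h) - iteratedDeriv 2 φ x - iteratedDeriv 3 φ x * h|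
        ≤ C₄ * h ^ 2 / 2 := fun x h hx hxh =>
    abs_taylor_one_remainder_le (convex_Ici (2 * m))
      (fun r hr => hder 2 (by norm_num) r (h2m.trans_le hr))
      (fun r hr => hder 3 (by norm_num) r (h2m.trans_le hr))
      (hle 4 le_rfl _ h2m) hx hxh
  have hE : ∀ ξ, |(1 - β ξ) * (iteratedDeriv 2 φ (d1 N y ξ + d1 N y (ξ + 1))
          - iteratedDeriv 2 φ (2 * d1 N y ξ))
        + (1 - β (ξ - 1)) * (iteratedDeriv 2 φ (d1 N y (ξ - 1) + d1 N y ξ)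
          - iteratedDeriv 2 φ (2 * d1 N y ξ))|
      ≤ eps N * C₃ * M₁ + eps N ^ 2 * (C₃ * M₂ + C₄ * M₃) := by
    intro ξ
    have ha := hym (ξ - 1)
    have hb := hym ξ
    have hc := hym (ξ + 1)
    have e₁ := eps_mul_d2 hN0 y ξ
    have e₀ := eps_mul_d2 hN0 y (ξ - 1)
    rw [sub_add_cancel] at e₀
    have s₁ : d1 N y ξ + d1 N y (ξ + 1) = 2 * d1 N y ξ + eps N * d2 N y ξ := by linarith
    have s₀ : d1 N y (ξ - 1) + d1 N y ξ = 2 * d1 N y ξ + -(eps N * d2 N y (ξ - 1)) := by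
      linarith
    rw [s₁, s₀]
    exact abs_weighted_stiffness_error_le hε (hη01 ξ).2 (hη01 (ξ - 1)).2
      (hle 3 (by norm_num) _ h2m (2 * d1 N y ξ) (Set.mem_Ici.2 (by linarith))) hC₄0
      (htaylor _ _ (by linarith) (by linarith)) (htaylor _ _ (by linarith) (by linarith))
      (eps_mul_d3 hN0 y ξ) (hM₁le ξ) (hM₂le ξ) (hM₃le ξ) (hM₃le (ξ - 1))
  by_cases hne : ∃ u, inU N u ∧ lpnorm N 2 (d1 N u) = 1
  · obtain ⟨u₀, hu₀, hn₀⟩ := hne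
    refine le_csInf ⟨_, u₀, hu₀, hn₀, rfl⟩ ?_
    rintro _ ⟨u, hu, hn, rfl⟩
    have hbdd : coercConst N (PhiBQNL N φ β) y ≤ svar (PhiBQNL N φ β) y u := by
      refine csInf_le ⟨-(9 * Cbound φ 2 m), ?_⟩ ⟨u, hu, hn, rfl⟩
      rintro _ ⟨w, hw, hwn, rfl⟩
      refine neg_le_svar_PhiBQC hN0 hφ (fun ξ => ?_) hη01 hm0 hym
        (hle 2 (by norm_num) m hm0) hw hwn
      have h1 := hη01 ξ
      have h0 := hη01 (ξ - 1)
      constructor <;> linarith [h1.1, h1.2, h0.1, h0.2]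
    have hmain := svar_PhiBQNL_sub_le hN0 hφ hηper (fun ξ => (hη01 ξ).2) hy.d1_periodic
      (fun ξ => hm0.trans_le (hym ξ))
      (fun ξ => hnonpos _ (by linarith [hym ξ, hym (ξ + 1)])) hE hu hn
    linarith
  · have hzero : ∀ Ψ, coercConst N Ψ y = 0 := by
      intro Ψ
      have hempty : { c : ℝ | ∃ u : ℤ → ℝ, inU N u ∧ lpnorm N 2 (d1 N u) = 1 ∧
          c = svar Ψ y u } = ∅ := by
        ext c
        simp only [Set.mem_ofPred_eq, Set.mem_empty_iff_false, iff_false]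
        rintro ⟨u, hu, hn, -⟩
        exact hne ⟨u, hu, hn⟩
      rw [coercConst, hempty, Real.sInf_empty]
    rw [hzero, hzero]
    have h1 : 0 ≤ 2 * eps N * C₃ * M₁ := by positivity
    have h2 : 0 ≤ 2 * eps N ^ 2 * (C₃ * M₂ + C₄ * M₃) := by positivity
    linarith
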